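/- In the reduction setup, suppose additionally there is ρ > 0 such that every learner over the simplex Δ(A) facing the oblivious adversary D (which reveals u^t ∈ A at time t, with utility of playing a ∈ A at time t equal to 1 if a = u^t and 0 otherwise) incurs expected average swap regret at least ρ. Then, with δ = M² e^{−nε²/2}, every learner over X facing the adversary that plays ũ^t = ψ(u^t) incurs expected average swap regret at least ρ − 2ε − 5δ; that is, E[ max_{φ : X → X} (1/T) Σ_{t=1}^T E_{x ∼ π^t} ⟨ũ^t, φ(x) − x⟩ ] ≥ ρ − 2ε − 5δ. -/

import Mathlib

/-! ## The reduction setup -/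

/-- A pure strategy of the tree-form decision problem: a choice of `i ∈ [d]`
together with, for each `j ∈ [n]`, a binary action (a sign).  Its
realization-form vector (`stratVec`) lies in `X_i ⊆ ℝ^{d×n}`. -/
abbrev Strat (d n : ℕ) := Fin d × (Fin n → Bool)

/-- The inner product of the two vectors in `{-1/√n, 1/√n}^n` encoded by the
sign patterns `s, s' : Fin n → Bool` (`true ↦ 1/√n`, `false ↦ -1/√n`). -/
noncomputable def ip (n : ℕ) (s s' : Fin n → Bool) : ℝ :=
  ∑ j, ((if s j then 1 else -1) / Real.sqrt n) * ((if s' j then 1 else -1) / Real.sqrt n)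

/-- The realization-form vector in `ℝ^{d×n}` of the pure strategy `x`: the
`x.1`-th row lies in `{-1/√n, 1/√n}^n` (signs given by `x.2`), other rows 0. -/
noncomputable def stratVec (d n : ℕ) (x : Strat d n) : Fin d → Fin n → ℝ :=
  fun i j => if i = x.1 then (if x.2 j then 1 else -1) / Real.sqrt n else 0

/-- The standard inner product on `ℝ^{d×n}`. -/
noncomputable def dot (d n : ℕ) (v w : Fin d → Fin n → ℝ) : ℝ :=
  ∑ i, ∑ j, v i j * w i j

/-- The action set `A = A_1 ⊔ ⋯ ⊔ A_d ⊔ {a*}`, with `A_i = {a_{i1}, …, a_{iM_i}}`: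
`some ⟨i, j⟩` is the action `a_{ij}` and `none` is the distinguished action `a*`. -/
abbrev Act (d : ℕ) (Mi : Fin d → ℕ) := Option ((i : Fin d) × Fin (Mi i))

/-- The sample space for the random vectors `ã_{ij}` (sign patterns, uniform). -/
abbrev Atil (d n : ℕ) (Mi : Fin d → ℕ) := (i : Fin d) → Fin (Mi i) → Fin n → Bool

/-- The random map `ψ : A → X`, sending `a_{ij}` to `ã_{ij} ∈ X_i` and `a*` to
the fixed element `x₀`. -/
def psi {d n : ℕ} {Mi : Fin d → ℕ} (x₀ : Strat d n) (atil : Atil d n Mi) :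
    Act d Mi → Strat d n
  | none => x₀
  | some p => (p.1, atil p.1 p.2)

/-- `firstTime T U a` is the first (1-indexed) iteration `t ∈ [T]` at which the
sequence `U` plays the action `a`, or `T` if this never happens. -/
noncomputable def firstTime {d : ℕ} {Mi : Fin d → ℕ} (T : ℕ) (U : Fin T → Act d Mi)
    (a : Act d Mi) : ℕ :=
  sInf ({T} ∪ {k | ∃ t : Fin T, U t = a ∧ k = t.val + 1})

open scoped Classical in
/-- The set of indices `j` with `⟨x, ã_{x.1 j}⟩ > ε`. -/
noncomputable def goodJ {d n : ℕ} {Mi : Fin d → ℕ} (atil : Atil d n Mi) (ε : ℝ)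
    (x : Strat d n) : Finset (Fin (Mi x.1)) :=
  Finset.univ.filter fun j => ε < ip n x.2 (atil x.1 j)

/-- `t_x`: if `⟨x, ã_{x.1 j}⟩ ≤ ε` for all `j`, then `t_x = 0`; otherwise
`t_x = t_{x.1 j}` for the largest `j` with `⟨x, ã_{x.1 j}⟩ > ε`. -/
noncomputable def txOf {d n : ℕ} {Mi : Fin d → ℕ} (T : ℕ) (U : Fin T → Act d Mi)
    (atil : Atil d n Mi) (ε : ℝ) (x : Strat d n) : ℕ :=
  if h : (goodJ atil ε x).Nonempty then
    firstTime T U (some ⟨x.1, (goodJ atil ε x).max' h⟩)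
  else 0

open scoped Classical in
/-- The distribution `p_x ∈ Δ(A)`: if `⟨x, ã_{x.1 j}⟩ ≤ ε` for all `j`, the
point mass on `a*`; otherwise, with `j` the largest index with
`⟨x, ã_{x.1 j}⟩ > ε` and `β = ⟨x, ã_{x.1 j}⟩`, mass `β` on `a_{x.1 j}` and
mass `1 - β` on `a*`. -/
noncomputable def pxval {d n : ℕ} {Mi : Fin d → ℕ} (atil : Atil d n Mi) (ε : ℝ)
    (x : Strat d n) (a : Act d Mi) : ℝ :=
  if h : (goodJ atil ε x).Nonempty then
    if a = some ⟨x.1, (goodJ atil ε x).max' h⟩ then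
      ip n x.2 (atil x.1 ((goodJ atil ε x).max' h))
    else if a = none then 1 - ip n x.2 (atil x.1 ((goodJ atil ε x).max' h))
    else 0
  else if a = none then 1 else 0

/-- The mixed strategy `π^t ∈ Δ(X)` played by the learner (with internal
random seed `ω`) at time `t`, as a function of the previously observed utility
vectors `ũ^1, …, ũ^{t-1}` (where `ũ^s = ψ(u^s)`). -/
def play {d n T : ℕ} {Mi : Fin d → ℕ} {Ω : Type}
    (π : Ω → (t : Fin T) → (Fin t.val → Strat d n) → Strat d n → ℝ)
    (x₀ : Strat d n) (atil : Atil d n Mi) (ω : Ω) (U : Fin T → Act d Mi)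
    (t : Fin T) : Strat d n → ℝ :=
  π ω t fun s => psi x₀ atil (U ⟨s.val, s.isLt.trans t.isLt⟩)

lemma ip_eq_sum_div (n : ℕ) (s s' : Fin n → Bool) :
    ip n s s' = (∑ j, (if s j then (1 : ℝ) else -1) * (if s' j then 1 else -1)) / n := by
  unfold ip
  rw [Finset.sum_div]
  refine Finset.sum_congr rfl fun j _ => ?_
  rw [div_mul_div_comm, Real.mul_self_sqrt (Nat.cast_nonneg n)]

lemma ip_comm (n : ℕ) (s s' : Fin n → Bool) : ip n s s' = ip n s' s :=
  Finset.sum_congr rfl fun _ _ => mul_comm _ _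

lemma ip_not (n : ℕ) (s s' : Fin n → Bool) : ip n (fun k => !s k) s' = -ip n s s' := by
  unfold ip
  rw [← Finset.sum_neg_distrib]
  refine Finset.sum_congr rfl fun j _ => ?_
  cases h : s j <;> simp [h, neg_div]

lemma ip_self {n : ℕ} (hn : 0 < n) (s : Fin n → Bool) : ip n s s = 1 := by
  have hn' : (n : ℝ) ≠ 0 := by positivity
  have h : ∀ j, (if s j then (1 : ℝ) else -1) * (if s j then 1 else -1) = 1 := fun j => by
    cases s j <;> simp
  simp [ip_eq_sum_div, h, hn']

lemma ip_le_one {n : ℕ} (hn : 0 < n) (s s' : Fin n → Bool) : ip n s s' ≤ 1 := by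
  rw [← ip_self hn s, ip_eq_sum_div, ip_eq_sum_div]
  refine div_le_div_of_nonneg_right (Finset.sum_le_sum fun j _ => ?_) (Nat.cast_nonneg n)
  cases s j <;> cases s' j <;> norm_num

lemma neg_one_le_ip {n : ℕ} (hn : 0 < n) (s s' : Fin n → Bool) : -1 ≤ ip n s s' := by
  have := ip_le_one hn (fun k => !s k) s'
  rw [ip_not] at this
  linarith

lemma dot_stratVec (d n : ℕ) (x y : Strat d n) :
    dot d n (stratVec d n x) (stratVec d n y) = if x.1 = y.1 then ip n x.2 y.2 else 0 := by
  unfold dot stratVec ip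
  rw [Finset.sum_eq_single x.1]
  · by_cases h : x.1 = y.1 <;> simp [h]
  · intro i _ hi
    simp [hi]
  · simp

/-- Moment generating function of a sign vector correlated with a fixed one. -/
lemma sum_exp_ip {n : ℕ} (hn : 0 < n) (ε : ℝ) (s : Fin n → Bool) :
    ∑ s' : Fin n → Bool, Real.exp (n * ε * ip n s s') = (2 * Real.cosh ε) ^ n := by
  have hn' : (n : ℝ) ≠ 0 := by positivity
  have h1 : ∀ s' : Fin n → Bool, Real.exp (n * ε * ip n s s') =
      ∏ j, Real.exp (ε * ((if s j then (1 : ℝ) else -1) * (if s' j then 1 else -1))) := by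
    intro s'
    rw [← Real.exp_sum, ip_eq_sum_div, ← Finset.mul_sum]
    congr 1
    field_simp
  simp_rw [h1]
  rw [← Fintype.prod_sum fun (j : Fin n) (b : Bool) =>
    Real.exp (ε * ((if s j then (1 : ℝ) else -1) * (if b then 1 else -1)))]
  have h2 : ∀ j : Fin n, ∑ b : Bool,
      Real.exp (ε * ((if s j then (1 : ℝ) else -1) * (if b then 1 else -1))) =
        2 * Real.cosh ε := by
    intro j
    rw [Real.cosh_eq]
    cases s j <;> simp <;> ring
  rw [Finset.prod_congr rfl fun j _ => h2 j, Finset.prod_const, Finset.card_univ, Fintype.card_fin]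

/-- Hoeffding's bound for the inner product of a fixed and a uniform sign vector. -/
lemma sum_tail_le {n : ℕ} (hn : 0 < n) {ε : ℝ} (hε : 0 < ε) (s : Fin n → Bool) :
    ∑ s' : Fin n → Bool, (if ε < ip n s s' then (1 : ℝ) else 0) ≤
      2 ^ n * Real.exp (-(n : ℝ) * ε ^ 2 / 2) := by
  have h1 : ∀ s' : Fin n → Bool, (if ε < ip n s s' then (1 : ℝ) else 0) ≤
      Real.exp (-(n * ε ^ 2)) * Real.exp (n * ε * ip n s s') := by
    intro s'
    rw [← Real.exp_add]
    split_ifs with h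
    · apply Real.one_le_exp
      have : 0 ≤ (n * ε) * (ip n s s' - ε) := by
        apply mul_nonneg <;> [positivity; linarith]
      nlinarith
    · positivity
  calc _ ≤ ∑ s' : Fin n → Bool, Real.exp (-(n * ε ^ 2)) * Real.exp (n * ε * ip n s s') :=
        Finset.sum_le_sum fun s' _ => h1 s'
    _ = Real.exp (-(n * ε ^ 2)) * (2 * Real.cosh ε) ^ n := by
        rw [← Finset.mul_sum, sum_exp_ip hn]
    _ ≤ Real.exp (-(n * ε ^ 2)) * (2 * Real.exp (ε ^ 2 / 2)) ^ n := by
        gcongr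
        exact Real.cosh_le_exp_half_sq ε
    _ = _ := by
        rw [mul_pow, ← Real.exp_nat_mul, mul_left_comm, ← Real.exp_add]
        ring_nf

/-- Flip the signs of the vector with index `q` according to `s`. -/
def flipAt {d n : ℕ} {Mi : Fin d → ℕ} (q : (i : Fin d) × Fin (Mi i)) (s : Fin n → Bool)
    (atil : Atil d n Mi) : Atil d n Mi :=
  fun i j k => if (⟨i, j⟩ : (i : Fin d) × Fin (Mi i)) = q then xor (s k) (atil i j k)
    else atil i j k

lemma flipAt_involutive {d n : ℕ} {Mi : Fin d → ℕ} (q : (i : Fin d) × Fin (Mi i))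
    (s : Fin n → Bool) : Function.Involutive (flipAt q s : Atil d n Mi → Atil d n Mi) := by
  intro atil
  funext i j k
  unfold flipAt
  split_ifs <;> simp

lemma flipAt_of_ne {d n : ℕ} {Mi : Fin d → ℕ} {p q : (i : Fin d) × Fin (Mi i)} (h : p ≠ q)
    (s : Fin n → Bool) (atil : Atil d n Mi) : flipAt q s atil p.1 p.2 = atil p.1 p.2 := by
  funext k
  simp [flipAt, h]

/-- A vector drawn independently of `ã_q` has inner product larger than `ε` with `ã_q` with
probability at most `exp (-nε²/2)`. -/
lemma avg_tail_le {d n : ℕ} {Mi : Fin d → ℕ} (hn : 0 < n) {ε : ℝ} (hε : 0 < ε)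
    (q : (i : Fin d) × Fin (Mi i)) {ι : Type*} [Fintype ι]
    (W : Atil d n Mi → ι → ℝ) (v : Atil d n Mi → ι → Fin n → Bool)
    (hW0 : ∀ atil x, 0 ≤ W atil x) (hW1 : ∀ atil, ∑ x, W atil x = 1)
    (hW : ∀ atil s, W (flipAt q s atil) = W atil)
    (hv : ∀ atil s, v (flipAt q s atil) = v atil) :
    ∑ atil : Atil d n Mi, ((Fintype.card (Atil d n Mi) : ℝ))⁻¹ *
      ∑ x, W atil x * (if ε < ip n (v atil x) (atil q.1 q.2) then 1 else 0) ≤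
        Real.exp (-(n : ℝ) * ε ^ 2 / 2) := by
  set F : Atil d n Mi → ℝ := fun atil =>
    ∑ x, W atil x * (if ε < ip n (v atil x) (atil q.1 q.2) then 1 else 0) with hF
  set E := Real.exp (-(n : ℝ) * ε ^ 2 / 2)
  have hshift : ∀ s : Fin n → Bool, ∑ atil, F (flipAt q s atil) = ∑ atil, F atil := fun s =>
    Equiv.sum_comp (flipAt_involutive q s).toPerm F
  have hinner : ∀ atil, ∑ s : Fin n → Bool, F (flipAt q s atil) ≤ 2 ^ n * E := by
    intro atil
    have hx : ∀ x, ∑ s : Fin n → Bool,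
        (if ε < ip n (v atil x) (flipAt q s atil q.1 q.2) then (1 : ℝ) else 0) ≤ 2 ^ n * E := by
      intro x
      have hinv : Function.Involutive
          (fun (s : Fin n → Bool) k => xor (s k) (atil q.1 q.2 k)) := by
        intro s
        funext k
        simp
      have h := Equiv.sum_comp (hinv.toPerm _)
        fun s => if ε < ip n (v atil x) s then (1 : ℝ) else 0
      refine le_trans (le_of_eq ?_) (sum_tail_le hn hε (v atil x))
      rw [← h]
      refine Finset.sum_congr rfl fun s _ => ?_
      have : flipAt q s atil q.1 q.2 = hinv.toPerm _ s := by
        funext k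
        simp [flipAt]
      rw [this]
    calc ∑ s : Fin n → Bool, F (flipAt q s atil)
        = ∑ x, W atil x * ∑ s : Fin n → Bool,
            (if ε < ip n (v atil x) (flipAt q s atil q.1 q.2) then (1 : ℝ) else 0) := by
          simp only [hF, hW, hv, Finset.mul_sum]
          exact Finset.sum_comm
      _ ≤ ∑ x, W atil x * (2 ^ n * E) :=
          Finset.sum_le_sum fun x _ => mul_le_mul_of_nonneg_left (hx x) (hW0 _ _)
      _ = 2 ^ n * E := by rw [← Finset.sum_mul, hW1, one_mul]
  have hsum : (2 : ℝ) ^ n * ∑ atil, F atil ≤ Fintype.card (Atil d n Mi) * (2 ^ n * E) := by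
    calc (2 : ℝ) ^ n * ∑ atil, F atil
        = ∑ s : Fin n → Bool, ∑ atil, F (flipAt q s atil) := by
          simp [hshift]
      _ = ∑ atil, ∑ s : Fin n → Bool, F (flipAt q s atil) := Finset.sum_comm
      _ ≤ ∑ _atil : Atil d n Mi, 2 ^ n * E := Finset.sum_le_sum fun a _ => hinner a
      _ = _ := by rw [Finset.sum_const, nsmul_eq_mul, Finset.card_univ]
  have hc : (0 : ℝ) < Fintype.card (Atil d n Mi) := by
    exact_mod_cast Fintype.card_pos
  rw [← Finset.mul_sum, inv_mul_le_iff₀ hc]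
  have h2 : (0 : ℝ) < 2 ^ n := by positivity
  refine le_of_mul_le_mul_left ?_ h2
  linarith

lemma pxval_nonneg {d n : ℕ} {Mi : Fin d → ℕ} (hn : 0 < n) (atil : Atil d n Mi) {ε : ℝ}
    (hε : 0 < ε) (x : Strat d n) (a : Act d Mi) : 0 ≤ pxval atil ε x a := by
  unfold pxval
  split_ifs with h
  · have := (goodJ atil ε x).max'_mem h
    simp only [goodJ, Finset.mem_filter] at this
    exact (hε.trans this.2).le
  · linarith [ip_le_one hn x.2 (atil x.1 ((goodJ atil ε x).max' h))]
  all_goals norm_num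

lemma sum_pxval {d n : ℕ} {Mi : Fin d → ℕ} (atil : Atil d n Mi) (ε : ℝ)
    (x : Strat d n) : ∑ a, pxval atil ε x a = 1 := by
  unfold pxval
  split_ifs with h
  · rw [Fintype.sum_option]
    simp
  · simp

/-- The indicator-sum of the events that two of the random vectors, or `x₀` and one of them,
have inner product below `-ε`. -/
noncomputable def corrCount {d n : ℕ} {Mi : Fin d → ℕ} (x₀ : Strat d n) (ε : ℝ)
    (atil : Atil d n Mi) : ℝ :=
  ∑ q : (i : Fin d) × Fin (Mi i),
    ((if ε < ip n (fun k => !x₀.2 k) (atil q.1 q.2) then 1 else 0) +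
      ∑ p : (i : Fin d) × Fin (Mi i),
        if p ≠ q then
          (if ε < ip n (fun k => !atil p.1 p.2 k) (atil q.1 q.2) then 1 else 0) else 0)

open scoped Classical in
/-- The indicator-sum of the events that `x` has inner product above `ε` with a random vector
whose action has not been played before iteration `t`. -/
noncomputable def freshCount {d n T : ℕ} {Mi : Fin d → ℕ} (U : Fin T → Act d Mi) (ε : ℝ)
    (atil : Atil d n Mi) (t : Fin T) (x : Strat d n) : ℝ :=
  ∑ q : (i : Fin d) × Fin (Mi i),
    if ∀ s < t, U s ≠ some q then (if ε < ip n x.2 (atil q.1 q.2) then 1 else 0) else 0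

lemma indicator_le_dot {d n : ℕ} {Mi : Fin d → ℕ} (hn : 0 < n) (x₀ : Strat d n)
    {ε : ℝ} (hε : 0 < ε) (atil : Atil d n Mi) (q : (i : Fin d) × Fin (Mi i)) (a : Act d Mi) :
    (if a = some q then (1 : ℝ) else 0) ≤
      dot d n (stratVec d n (psi x₀ atil (some q))) (stratVec d n (psi x₀ atil a)) +
        ε + corrCount x₀ ε atil := by
  have hterm : ∀ q' : (i : Fin d) × Fin (Mi i), 0 ≤ ∑ p : (i : Fin d) × Fin (Mi i),
      if p ≠ q' then
        (if ε < ip n (fun k => !atil p.1 p.2 k) (atil q'.1 q'.2) then (1 : ℝ) else 0) else 0 :=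
    fun q' => Finset.sum_nonneg fun p _ => by split_ifs <;> norm_num
  have hind : ∀ q' : (i : Fin d) × Fin (Mi i),
      (0 : ℝ) ≤ if ε < ip n (fun k => !x₀.2 k) (atil q'.1 q'.2) then 1 else 0 :=
    fun q' => by split_ifs <;> norm_num
  have hq : _ ≤ corrCount x₀ ε atil :=
    Finset.single_le_sum (f := fun q' : (i : Fin d) × Fin (Mi i) =>
      ((if ε < ip n (fun k => !x₀.2 k) (atil q'.1 q'.2) then (1 : ℝ) else 0) +
      ∑ p : (i : Fin d) × Fin (Mi i), if p ≠ q' then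
        (if ε < ip n (fun k => !atil p.1 p.2 k) (atil q'.1 q'.2) then (1 : ℝ) else 0) else 0))
      (fun q' _ => add_nonneg (hind q') (hterm q')) (Finset.mem_univ q)
  have hC : 0 ≤ corrCount x₀ ε atil := (add_nonneg (hind q) (hterm q)).trans hq
  rcases a with _ | p
  · simp only [psi, reduceCtorEq, if_false]
    rw [dot_stratVec]
    dsimp only
    by_cases h : q.1 = x₀.1
    · rw [if_pos h]
      have h1 := neg_one_le_ip hn (atil q.1 q.2) x₀.2
      by_cases hb : ε < ip n (fun k => !x₀.2 k) (atil q.1 q.2)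
      · have h2 := hterm q
        simp only [hb, if_true] at hq
        linarith
      · rw [ip_not, ip_comm] at hb
        linarith
    · rw [if_neg h]
      linarith
  · by_cases hpq : p = q
    · subst hpq
      simp only [psi, if_true, dot_stratVec, ip_self hn]
      linarith
    · have hne : (some p : Act d Mi) ≠ some q := fun h => hpq (Option.some.inj h)
      simp only [psi, hne, if_false]
      rw [dot_stratVec]
      dsimp only
      by_cases h : q.1 = p.1
      · rw [if_pos h]
        have h1 := neg_one_le_ip hn (atil q.1 q.2) (atil p.1 p.2)
        by_cases hb : ε < ip n (fun k => !atil p.1 p.2 k) (atil q.1 q.2)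
        · have h2 := hind q
          have h3 := Finset.single_le_sum (f := fun p' : (i : Fin d) × Fin (Mi i) =>
            if p' ≠ q then (if ε < ip n (fun k => !atil p'.1 p'.2 k) (atil q.1 q.2)
              then (1 : ℝ) else 0) else 0)
            (fun p' _ => by split_ifs <;> norm_num) (Finset.mem_univ p)
          simp only [hb, if_true, ne_eq, hpq, not_false_eq_true] at h3
          simp only [ne_eq] at hq
          linarith
        · rw [ip_not, ip_comm] at hb
          linarith
      · rw [if_neg h]
        linarith

lemma dot_le_pxval {d n T : ℕ} {Mi : Fin d → ℕ} (hn : 0 < n) (x₀ : Strat d n)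
    {ε : ℝ} (hε : 0 < ε) (atil : Atil d n Mi) (U : Fin T → Act d Mi)
    (hinc : ∀ (t t' : Fin T) (i : Fin d) (j j' : Fin (Mi i)),
      t ≤ t' → U t = some ⟨i, j⟩ → U t' = some ⟨i, j'⟩ → j ≤ j')
    (t : Fin T) (hU : U t ≠ none) (x : Strat d n) :
    dot d n (stratVec d n (psi x₀ atil (U t))) (stratVec d n x) ≤
      pxval atil ε x (U t) + ε + freshCount U ε atil t x := by
  classical
  have hterm : ∀ q : (i : Fin d) × Fin (Mi i), (0 : ℝ) ≤
      if ∀ s < t, U s ≠ some q then (if ε < ip n x.2 (atil q.1 q.2) then 1 else 0) else 0 :=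
    fun q => by split_ifs <;> norm_num
  have hq : ∀ q : (i : Fin d) × Fin (Mi i),
      (if ∀ s < t, U s ≠ some q then (if ε < ip n x.2 (atil q.1 q.2) then (1 : ℝ) else 0) else 0)
        ≤ freshCount U ε atil t x := fun q => by
    unfold freshCount
    convert Finset.single_le_sum (f := fun q : (i : Fin d) × Fin (Mi i) =>
      if ∀ s < t, U s ≠ some q then (if ε < ip n x.2 (atil q.1 q.2) then (1 : ℝ) else 0) else 0)
      (fun q _ => hterm q) (Finset.mem_univ q)
  have hp := pxval_nonneg hn atil hε x (U t)
  obtain ⟨⟨i, j⟩, hUt⟩ := Option.ne_none_iff_exists'.1 hU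
  have hF : 0 ≤ freshCount U ε atil t x := (hterm ⟨i, j⟩).trans (hq ⟨i, j⟩)
  obtain ⟨i', v⟩ := x
  rw [hUt] at hp ⊢
  simp only [psi]
  rw [dot_stratVec]
  dsimp only
  by_cases h : i = i'
  swap
  · rw [if_neg h]
    linarith
  subst h
  rw [if_pos rfl, ip_comm]
  by_cases hb : ε < ip n v (atil i j)
  swap
  · linarith
  have hmem : j ∈ goodJ atil ε (i, v) := by simp [goodJ, hb]
  have hne : (goodJ atil ε (i, v)).Nonempty := ⟨j, hmem⟩
  rcases (Finset.le_max' _ j hmem).eq_or_lt with heq | hlt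
  · have : pxval atil ε (i, v) (some ⟨i, j⟩) = ip n v (atil i j) := by
      unfold pxval
      rw [dif_pos hne, if_pos (by rw [← heq]), ← heq]
    linarith
  · have hm := (goodJ atil ε (i, v)).max'_mem hne
    have hfresh := hq ⟨i, (goodJ atil ε (i, v)).max' hne⟩
    rw [if_pos, if_pos] at hfresh
    · linarith [ip_le_one hn v (atil i j)]
    · simp only [goodJ, Finset.mem_filter] at hm
      exact hm.2
    · intro s hs hUs
      exact absurd (hinc s t i _ _ hs.le hUs hUt) (not_le.2 hlt)

/-- Expected value of `corrCount`. -/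
lemma avg_corrCount_le {d n : ℕ} {Mi : Fin d → ℕ} (hn : 0 < n) (x₀ : Strat d n)
    {ε : ℝ} (hε : 0 < ε) :
    ∑ atil : Atil d n Mi, ((Fintype.card (Atil d n Mi) : ℝ))⁻¹ * corrCount x₀ ε atil ≤
      ((∑ i, Mi i : ℕ) + (∑ i, Mi i : ℕ) ^ 2) * Real.exp (-(n : ℝ) * ε ^ 2 / 2) := by
  set E := Real.exp (-(n : ℝ) * ε ^ 2 / 2)
  set c := ((Fintype.card (Atil d n Mi) : ℝ))⁻¹
  have h0 : ∀ q : (i : Fin d) × Fin (Mi i), ∑ atil : Atil d n Mi, c *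
      (if ε < ip n (fun k => !x₀.2 k) (atil q.1 q.2) then 1 else 0) ≤ E := fun q => by
    have h := avg_tail_le (ι := Unit) hn hε q (fun _ _ => 1) (fun _ _ k => !x₀.2 k)
      (by simp) (by simp) (by simp) (by simp)
    simp only [Finset.univ_unique, Finset.sum_singleton, one_mul] at h
    exact h
  have h1 : ∀ q p : (i : Fin d) × Fin (Mi i), ∑ atil : Atil d n Mi, c *
      (if p ≠ q then (if ε < ip n (fun k => !atil p.1 p.2 k) (atil q.1 q.2) then 1 else 0)
        else 0) ≤ E := fun q p => by
    by_cases hpq : p = q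
    · simp only [hpq, ne_eq, not_true_eq_false, if_false, mul_zero, Finset.sum_const_zero]
      positivity
    · have h := avg_tail_le (ι := Unit) hn hε q (fun _ _ => 1)
        (fun atil _ k => !atil p.1 p.2 k) (by simp) (by simp) (by simp)
        (fun atil s => by simp [flipAt_of_ne hpq])
      simp only [Finset.univ_unique, Finset.sum_singleton, one_mul] at h
      simp only [ne_eq, hpq, not_false_eq_true, if_true]
      exact h
  calc _ = ∑ q : (i : Fin d) × Fin (Mi i), (∑ atil : Atil d n Mi, c *
          (if ε < ip n (fun k => !x₀.2 k) (atil q.1 q.2) then 1 else 0) +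
        ∑ p : (i : Fin d) × Fin (Mi i), ∑ atil : Atil d n Mi, c *
          (if p ≠ q then (if ε < ip n (fun k => !atil p.1 p.2 k) (atil q.1 q.2) then 1 else 0)
            else 0)) := by
        simp only [corrCount, Finset.mul_sum]
        rw [Finset.sum_comm]
        refine Finset.sum_congr rfl fun q _ => ?_
        simp only [mul_add, Finset.mul_sum, Finset.sum_add_distrib]
        rw [Finset.sum_comm (s := (Finset.univ : Finset ((i : Fin d) × Fin (Mi i))))]
    _ ≤ ∑ _q : (i : Fin d) × Fin (Mi i), (E + ∑ _p : (i : Fin d) × Fin (Mi i), E) :=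
        Finset.sum_le_sum fun q _ => add_le_add (h0 q) (Finset.sum_le_sum fun p _ => h1 q p)
    _ = _ := by
        simp only [Finset.sum_const, Finset.card_univ, Fintype.card_sigma, Fintype.card_fin,
          nsmul_eq_mul]
        ring

/-- Expected value of `freshCount` at the strategy played by a learner. -/
lemma avg_freshCount_le {d n T : ℕ} {Mi : Fin d → ℕ} {Ω : Type} (hn : 0 < n)
    (x₀ : Strat d n) {ε : ℝ} (hε : 0 < ε)
    (π : Ω → (t : Fin T) → (Fin t.val → Strat d n) → Strat d n → ℝ)
    (hπ0 : ∀ ω t h x, 0 ≤ π ω t h x) (hπ1 : ∀ ω t h, ∑ x, π ω t h x = 1)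
    (ω : Ω) (U : Fin T → Act d Mi) (t : Fin T) :
    ∑ atil : Atil d n Mi, ((Fintype.card (Atil d n Mi) : ℝ))⁻¹ *
      ∑ x, play π x₀ atil ω U t x * freshCount U ε atil t x ≤
        (∑ i, Mi i : ℕ) * Real.exp (-(n : ℝ) * ε ^ 2 / 2) := by
  classical
  set E := Real.exp (-(n : ℝ) * ε ^ 2 / 2)
  set c := ((Fintype.card (Atil d n Mi) : ℝ))⁻¹
  have h1 : ∀ q : (i : Fin d) × Fin (Mi i), ∑ atil : Atil d n Mi, c *
      ∑ x, play π x₀ atil ω U t x * (if ∀ s < t, U s ≠ some q then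
        (if ε < ip n x.2 (atil q.1 q.2) then 1 else 0) else 0) ≤ E := fun q => by
    by_cases hq : ∀ s < t, U s ≠ some q
    · simp only [if_pos hq]
      refine avg_tail_le hn hε q (fun atil x => play π x₀ atil ω U t x) (fun _ x => x.2)
        (fun _ _ => hπ0 _ _ _ _) (fun _ => hπ1 _ _ _) (fun atil s => ?_) (fun _ _ => rfl)
      have hhist : (fun s' : Fin t.val =>
          psi x₀ (flipAt q s atil) (U ⟨s'.val, s'.isLt.trans t.isLt⟩)) =
          fun s' => psi x₀ atil (U ⟨s'.val, s'.isLt.trans t.isLt⟩) := by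
        funext s'
        have hs' := hq ⟨s'.val, s'.isLt.trans t.isLt⟩ s'.isLt
        rcases hU : U ⟨s'.val, s'.isLt.trans t.isLt⟩ with _ | p
        · rfl
        · have hpq : p ≠ q := fun h => hs' (by rw [hU, h])
          simp [psi, flipAt_of_ne hpq]
      unfold play
      simp only [hhist]
    · simp only [if_neg hq, mul_zero, Finset.sum_const_zero]
      positivity
  calc _ = ∑ q : (i : Fin d) × Fin (Mi i), ∑ atil : Atil d n Mi, c *
      ∑ x, play π x₀ atil ω U t x * (if ∀ s < t, U s ≠ some q then
        (if ε < ip n x.2 (atil q.1 q.2) then 1 else 0) else 0) := by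
        rw [Finset.sum_comm]
        refine Finset.sum_congr rfl fun atil _ => ?_
        rw [← Finset.mul_sum, Finset.sum_comm]
        congr 1
        refine Finset.sum_congr rfl fun x _ => ?_
        rw [← Finset.mul_sum]
        unfold freshCount
        congr!
    _ ≤ ∑ _q : (i : Fin d) × Fin (Mi i), E := Finset.sum_le_sum fun q _ => h1 q
    _ = _ := by
        simp only [Finset.sum_const, Finset.card_univ, Fintype.card_sigma, Fintype.card_fin,
          nsmul_eq_mul]

/-- The swap regret of the learner that plays `a ∼ p_x` with `x ∼ P t` is at most that of the
learner playing `P`, up to the error terms. -/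
lemma simplex_regret_le {d n T : ℕ} {Mi : Fin d → ℕ} (hn : 0 < n) (hT : 0 < T)
    (x₀ : Strat d n) {ε : ℝ} (hε : 0 < ε) (atil : Atil d n Mi) (U : Fin T → Act d Mi)
    (hU : ∀ t, U t ≠ none)
    (hinc : ∀ (t t' : Fin T) (i : Fin d) (j j' : Fin (Mi i)),
      t ≤ t' → U t = some ⟨i, j⟩ → U t' = some ⟨i, j'⟩ → j ≤ j')
    (P : Fin T → Strat d n → ℝ) (hP0 : ∀ t x, 0 ≤ P t x) (hP1 : ∀ t, ∑ x, P t x = 1) :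
    (⨆ φbar : Act d Mi → Act d Mi, (1 / (T : ℝ)) * ∑ t : Fin T,
      ((∑ a, (∑ x, P t x * pxval atil ε x a) * (if φbar a = U t then 1 else 0)) -
        ∑ a, (∑ x, P t x * pxval atil ε x a) * (if a = U t then 1 else 0))) ≤
    (⨆ φ : Strat d n → Strat d n, (1 / (T : ℝ)) * ∑ t : Fin T, ∑ x : Strat d n,
      P t x * (dot d n (stratVec d n (psi x₀ atil (U t))) (stratVec d n (φ x)) -
        dot d n (stratVec d n (psi x₀ atil (U t))) (stratVec d n x))) +
    (2 * ε + corrCount x₀ ε atil +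
      (1 / (T : ℝ)) * ∑ t : Fin T, ∑ x, P t x * freshCount U ε atil t x) := by
  set c : Fin T → Strat d n → ℝ := fun t y =>
    dot d n (stratVec d n (psi x₀ atil (U t))) (stratVec d n y) with hc
  set p : Strat d n → Act d Mi → ℝ := pxval atil ε with hp
  set B := corrCount x₀ ε atil
  have hT' : (T : ℝ) ≠ 0 := by positivity
  have : Nonempty (Strat d n) := ⟨x₀⟩
  refine ciSup_le fun φbar => ?_
  choose φ hφ using fun x : Strat d n => Finite.exists_max fun y => ∑ t, P t x * c t y
  have hsup := le_ciSup (f := fun φ : Strat d n → Strat d n =>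
    (1 / (T : ℝ)) * ∑ t : Fin T, ∑ x : Strat d n, P t x * (c t (φ x) - c t x))
    (Set.finite_range _).bddAbove φ
  refine le_trans ?_ (add_le_add_left hsup _)
  have hswap : ∑ t, ∑ a, (∑ x, P t x * p x a) * (if φbar a = U t then (1 : ℝ) else 0) ≤
      ∑ t, ∑ x, P t x * c t (φ x) + T * (ε + B) := by
    have hind : ∀ t a, (if φbar a = U t then (1 : ℝ) else 0) ≤
        c t (psi x₀ atil (φbar a)) + (ε + B) := by
      intro t a
      obtain ⟨q, hq⟩ := Option.ne_none_iff_exists'.1 (hU t)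
      have := indicator_le_dot hn x₀ hε atil q (φbar a)
      simp only [hc, hq]
      linarith
    calc _ ≤ ∑ t, ∑ a, (∑ x, P t x * p x a) * (c t (psi x₀ atil (φbar a)) + (ε + B)) := by
          gcongr with t _ a _
          · exact Finset.sum_nonneg fun x _ =>
              mul_nonneg (hP0 t x) (pxval_nonneg hn atil hε x a)
          · exact hind t a
      _ = ∑ x, ∑ a, p x a * ∑ t, P t x * c t (psi x₀ atil (φbar a)) + T * (ε + B) := by
          have h1 : ∀ t, ∑ a, ∑ x, P t x * p x a = 1 := fun t => by
            rw [Finset.sum_comm]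
            simp only [← Finset.mul_sum, hp, sum_pxval, mul_one, hP1]
          simp only [mul_add (∑ x, P _ x * p x _), Finset.sum_add_distrib]
          congr 1
          · simp only [Finset.sum_mul, Finset.mul_sum]
            rw [Finset.sum_comm]
            rw [Finset.sum_comm (s := (Finset.univ : Finset (Strat d n)))]
            refine Finset.sum_congr rfl fun a _ => ?_
            rw [Finset.sum_comm]
            refine Finset.sum_congr rfl fun x _ => Finset.sum_congr rfl fun t _ => ?_
            ring
          · simp [← Finset.sum_mul, h1, ← mul_add]
      _ ≤ ∑ x, ∑ a, p x a * ∑ t, P t x * c t (φ x) + T * (ε + B) := by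
          refine add_le_add_left (Finset.sum_le_sum fun x _ => Finset.sum_le_sum fun a _ => ?_) _
          exact mul_le_mul_of_nonneg_left (hφ x _) (pxval_nonneg hn atil hε x a)
      _ = _ := by
          simp only [← Finset.sum_mul, hp, sum_pxval, one_mul]
          rw [Finset.sum_comm]
  have hstay : ∑ t, ∑ x, P t x * c t x ≤
      ∑ t, ∑ a, (∑ x, P t x * p x a) * (if a = U t then (1 : ℝ) else 0) + T * ε +
        ∑ t, ∑ x, P t x * freshCount U ε atil t x := by
    calc _ ≤ ∑ t, ∑ x, P t x * (p x (U t) + ε + freshCount U ε atil t x) := by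
          gcongr with t _ x _
          · exact hP0 t x
          · exact dot_le_pxval hn x₀ hε atil U hinc t (hU t) x
      _ = _ := by
          simp [mul_add, Finset.sum_add_distrib, ← Finset.sum_mul, hP1]
  have hkey : ∑ t : Fin T,
      ((∑ a, (∑ x, P t x * p x a) * (if φbar a = U t then (1 : ℝ) else 0)) -
        ∑ a, (∑ x, P t x * p x a) * (if a = U t then 1 else 0)) ≤
      ∑ t : Fin T, ∑ x : Strat d n, P t x * (c t (φ x) - c t x) +
        T * (2 * ε + B) + ∑ t : Fin T, ∑ x, P t x * freshCount U ε atil t x := by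
    simp only [mul_sub, Finset.sum_sub_distrib]
    linarith
  have hinv : 0 ≤ 1 / (T : ℝ) := by positivity
  refine (mul_le_mul_of_nonneg_left hkey hinv).trans (le_of_eq ?_)
  field_simp
  ring

/-- Averaging a pointwise inequality with an error term that is small on average over `α`. -/
lemma weighted_sum_le {Ω α β : Type*} [Fintype Ω] [Fintype α] [Fintype β]
    (w : Ω → ℝ) (hw0 : ∀ ω, 0 ≤ w ω) (hw1 : ∑ ω, w ω = 1) (c : ℝ) (hc : 0 ≤ c)
    (D : β → ℝ) (hD0 : ∀ U, 0 ≤ D U) (hD1 : ∑ U, D U = 1)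
    (S' S Y : Ω → α → β → ℝ) (K : ℝ)
    (hS : ∀ ω a U, 0 < D U → S' ω a U ≤ S ω a U + Y ω a U)
    (hY : ∀ ω U, ∑ a, c * Y ω a U ≤ K) :
    ∑ ω, w ω * ∑ a, c * ∑ U, D U * S' ω a U ≤
      ∑ ω, w ω * ∑ a, c * ∑ U, D U * S ω a U + K := by
  have h : ∀ ω, ∑ a, c * ∑ U, D U * S' ω a U ≤ ∑ a, c * ∑ U, D U * S ω a U + K := by
    intro ω
    calc _ ≤ ∑ a, c * ∑ U, D U * (S ω a U + Y ω a U) := by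
          gcongr ∑ a, c * ∑ U, ?_ with a _ U _
          rcases (hD0 U).eq_or_lt with h | h
          · simp [← h]
          · exact mul_le_mul_of_nonneg_left (hS ω a U h) h.le
      _ = ∑ a, c * ∑ U, D U * S ω a U + ∑ U, D U * ∑ a, c * Y ω a U := by
          simp only [mul_add, Finset.sum_add_distrib, Finset.mul_sum]
          congr 1
          rw [Finset.sum_comm]
          refine Finset.sum_congr rfl fun U _ => Finset.sum_congr rfl fun a _ => ?_
          ring
      _ ≤ ∑ a, c * ∑ U, D U * S ω a U + ∑ U, D U * K := by
          gcongr with U _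
          · exact hD0 U
          · exact hY ω U
      _ = _ := by rw [← Finset.sum_mul, hD1, one_mul]
  calc _ ≤ ∑ ω, w ω * (∑ a, c * ∑ U, D U * S ω a U + K) :=
        Finset.sum_le_sum fun ω _ => mul_le_mul_of_nonneg_left (h ω) (hw0 ω)
    _ = _ := by
        simp only [mul_add, Finset.sum_add_distrib, ← Finset.sum_mul, hw1, one_mul]

/-!
STATEMENT 9: In the reduction setup, suppose every (possibly randomized)
learner over the simplex `Δ(A)` facing the oblivious adversary `D` (which
reveals `u^t` at time `t`, the utility of `a ∈ A` at time `t` being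
`1` if `a = u^t` and `0` otherwise) has expected average swap regret at least
`ρ`.  Then, with `δ = M² e^{-nε²/2}`, every (possibly randomized) learner over
`X` facing the adversary that plays `ũ^t = ψ(u^t)` has expected average swap
regret at least `ρ - 2ε - 5δ`:
`E[max_{φ : X → X} (1/T) ∑_t E_{x ∼ π^t} ⟨ũ^t, φ(x) - x⟩] ≥ ρ - 2ε - 5δ`.
-/
theorem stmt9 (d n T M : ℕ) (hd : 0 < d) (hn : 0 < n) (hT : 0 < T)
    (Mi : Fin d → ℕ) (hM : ∑ i, Mi i = M) (ε : ℝ) (hε : 0 < ε)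
    (x₀ : Strat d n)
    (D : (Fin T → Act d Mi) → ℝ)
    (hD0 : ∀ U, 0 ≤ D U) (hD1 : ∑ U, D U = 1)
    (hsupp : ∀ U, 0 < D U → ∀ t, U t ≠ none)
    (hinc : ∀ U, 0 < D U → ∀ (t t' : Fin T) (i : Fin d) (j j' : Fin (Mi i)),
      t ≤ t' → U t = some ⟨i, j⟩ → U t' = some ⟨i, j'⟩ → j ≤ j')
    (ρ : ℝ) (hρ : 0 < ρ)
    (hsimplex : ∀ (Ω' : Type) [Fintype Ω'] (w' : Ω' → ℝ),
      (∀ ω', 0 ≤ w' ω') → (∑ ω', w' ω') = 1 →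
      ∀ πbar : Ω' → (t : Fin T) → (Fin t.val → Act d Mi) → Act d Mi → ℝ,
        (∀ ω' t h a, 0 ≤ πbar ω' t h a) → (∀ ω' t h, ∑ a, πbar ω' t h a = 1) →
        ρ ≤ ∑ ω', w' ω' * ∑ U, D U *
          (⨆ φbar : Act d Mi → Act d Mi, (1 / (T : ℝ)) * ∑ t : Fin T,
            ((∑ a, πbar ω' t (fun s => U ⟨s.val, s.isLt.trans t.isLt⟩) a *
                (if φbar a = U t then 1 else 0)) -
              ∑ a, πbar ω' t (fun s => U ⟨s.val, s.isLt.trans t.isLt⟩) a *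
                (if a = U t then 1 else 0))))
    (Ω : Type) [Fintype Ω] (w : Ω → ℝ) (hw0 : ∀ ω, 0 ≤ w ω) (hw1 : ∑ ω, w ω = 1)
    (π : Ω → (t : Fin T) → (Fin t.val → Strat d n) → Strat d n → ℝ)
    (hπ0 : ∀ ω t h x, 0 ≤ π ω t h x) (hπ1 : ∀ ω t h, ∑ x, π ω t h x = 1) :
    ρ - 2 * ε - 5 * ((M : ℝ) ^ 2 * Real.exp (-(n : ℝ) * ε ^ 2 / 2))
      ≤ ∑ ω, w ω * ∑ atil : Atil d n Mi, ((Fintype.card (Atil d n Mi) : ℝ))⁻¹ *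
          ∑ U, D U *
            (⨆ φ : Strat d n → Strat d n, (1 / (T : ℝ)) * ∑ t : Fin T, ∑ x : Strat d n,
              play π x₀ atil ω U t x *
                (dot d n (stratVec d n (psi x₀ atil (U t))) (stratVec d n (φ x)) -
                  dot d n (stratVec d n (psi x₀ atil (U t))) (stratVec d n x))) := by
  subst hM
  set E := Real.exp (-(n : ℝ) * ε ^ 2 / 2)
  set m : ℕ := ∑ i, Mi i
  have hE : 0 ≤ E := (Real.exp_pos _).le
  have hcard : (Fintype.card (Atil d n Mi) : ℝ) ≠ 0 := by
    exact_mod_cast Fintype.card_ne_zero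
  have hc : 0 ≤ ((Fintype.card (Atil d n Mi) : ℝ))⁻¹ := by positivity
  have hbar := hsimplex (Ω × Atil d n Mi)
    (fun z => w z.1 * ((Fintype.card (Atil d n Mi) : ℝ))⁻¹)
    (fun z => mul_nonneg (hw0 z.1) hc)
    (by
      rw [Fintype.sum_prod_type]
      simp only [Finset.sum_const, Finset.card_univ, nsmul_eq_mul, mul_left_comm _ (w _),
        mul_inv_cancel₀ hcard, mul_one, hw1])
    (fun z t h a => ∑ x, π z.1 t (fun s => psi x₀ z.2 (h s)) x * pxval z.2 ε x a)
    (fun z t h a => Finset.sum_nonneg fun x _ =>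
      mul_nonneg (hπ0 _ _ _ _) (pxval_nonneg hn z.2 hε x a))
    (fun z t h => by
      rw [Finset.sum_comm]
      simp only [← Finset.mul_sum, sum_pxval, mul_one, hπ1])
  rw [Fintype.sum_prod_type] at hbar
  simp only [mul_assoc (w _)] at hbar
  have hY : ∀ ω (U : Fin T → Act d Mi), ∑ atil : Atil d n Mi,
      ((Fintype.card (Atil d n Mi) : ℝ))⁻¹ * (2 * ε + corrCount x₀ ε atil +
        (1 / (T : ℝ)) * ∑ t : Fin T, ∑ x, play π x₀ atil ω U t x * freshCount U ε atil t x) ≤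
      2 * ε + (m + (m : ℝ) ^ 2) * E + m * E := by
    intro ω U
    have hT' : (T : ℝ) ≠ 0 := by positivity
    have h1 := avg_corrCount_le (Mi := Mi) hn x₀ hε
    have h2 := Finset.sum_le_sum fun t (_ : t ∈ Finset.univ) =>
      avg_freshCount_le hn x₀ hε π hπ0 hπ1 ω U t
    rw [Finset.sum_comm] at h2
    simp only [mul_add, Finset.sum_add_distrib]
    refine add_le_add (add_le_add (le_of_eq ?_) h1) ?_
    · rw [Finset.sum_const, Finset.card_univ, nsmul_eq_mul, mul_inv_cancel_left₀ hcard]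
    · calc _ = (1 / (T : ℝ)) * ∑ atil : Atil d n Mi, ∑ t : Fin T,
            ((Fintype.card (Atil d n Mi) : ℝ))⁻¹ *
              ∑ x, play π x₀ atil ω U t x * freshCount U ε atil t x := by
            simp only [← Finset.mul_sum]
            ring
        _ ≤ (1 / (T : ℝ)) * ∑ t : Fin T, (m : ℝ) * E :=
            mul_le_mul_of_nonneg_left h2 (by positivity)
        _ = m * E := by
            simp only [Finset.sum_const, Finset.card_univ, Fintype.card_fin, nsmul_eq_mul]
            field_simp
  have hmain := weighted_sum_le w hw0 hw1 _ hc D hD0 hD1 _ _ _ _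
    (fun ω atil U hDU => simplex_regret_le hn hT x₀ hε atil U (hsupp U hDU) (hinc U hDU)
      (play π x₀ atil ω U) (fun _ _ => hπ0 _ _ _ _) (fun _ => hπ1 _ _ _)) hY
  have hmm : (m : ℝ) ≤ (m : ℝ) ^ 2 := by exact_mod_cast Nat.le_self_pow two_ne_zero m
  have hmE : (m : ℝ) * E ≤ (m : ℝ) ^ 2 * E := mul_le_mul_of_nonneg_right hmm hE
  have hmE0 : 0 ≤ (m : ℝ) ^ 2 * E := by positivity
  simp only [Finset.mul_sum _ _ (w _)] at hmain ⊢
  have := hbar.trans hmain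
  linarith
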